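/- arXiv:2503.11107 — 3 statements merged into one kernel-verified Lean document; each statement's English description precedes it below -/
import Mathlib

section
/- Let m ≥ 1 and let A and B be finite multisets with all elements in {1,...,m}. If A contains at least m elements (counted with multiplicity) and B contains at least m elements (counted with multiplicity), then the pair (A,B) is reducible, i.e., there exist a nonempty sub-multiset A₀ of A and a nonempty sub-multiset B₀ of B whose element sums are equal. -/
/-- A pair `(A, B)` of multisets of naturals is *reducible* if there exist
nonempty sub-multisets `A₀ ≤ A` and `B₀ ≤ B` with equal element sums. -/
def Reducible (A B : Multiset ℕ) : Prop :=
  ∃ A₀ B₀ : Multiset ℕ, A₀ ≤ A ∧ B₀ ≤ B ∧ A₀ ≠ 0 ∧ B₀ ≠ 0 ∧ A₀.sum = B₀.sum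

theorem Reducible.symm {A B : Multiset ℕ} (h : Reducible A B) : Reducible B A := by
  obtain ⟨A₀, B₀, hA, hB, hA0, hB0, hsum⟩ := h
  exact ⟨B₀, A₀, hB, hA, hB0, hA0, hsum.symm⟩

theorem Reducible.mono {A A' B B' : Multiset ℕ} (hA : A ≤ A') (hB : B ≤ B')
    (h : Reducible A B) : Reducible A' B' := by
  obtain ⟨A₀, B₀, hA₀, hB₀, hA0, hB0, hsum⟩ := h
  exact ⟨A₀, B₀, hA₀.trans hA, hB₀.trans hB, hA0, hB0, hsum⟩

theorem List.sum_take_mono (l : List ℕ) : Monotone fun i => (l.take i).sum := by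
  intro i j hij
  obtain ⟨d, rfl⟩ := Nat.exists_eq_add_of_le hij
  simp [List.take_add]

/-- Two prefix sums of `l` with a strict inequality bound a nonempty block of `l`. -/
theorem List.exists_le_sum_add_sum_take {l : List ℕ} {i j : ℕ}
    (h : (l.take i).sum < (l.take j).sum) :
    ∃ C : Multiset ℕ, C ≤ (l : Multiset ℕ) ∧ C ≠ 0 ∧ (l.take i).sum + C.sum = (l.take j).sum := by
  have hij : i ≤ j := (l.sum_take_mono.reflect_lt h).le
  obtain ⟨d, rfl⟩ := Nat.exists_eq_add_of_le hij
  rw [List.take_add, List.sum_append] at h ⊢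
  refine ⟨((l.drop i).take d : List ℕ), ?_, ?_, by simp⟩
  · exact ((List.take_sublist _ _).trans (List.drop_sublist _ _)).subperm
  · intro h0
    rw [Multiset.coe_eq_zero] at h0
    simp [h0] at h

/-- Any `s ≤ b.sum` exceeds some prefix sum of `b` by less than a bound on the entries of `b`. -/
theorem List.exists_sum_take_le_lt_add {m : ℕ} (hm : 1 ≤ m) {b : List ℕ}
    (hb : ∀ x ∈ b, x ≤ m) {s : ℕ} (hs : s ≤ b.sum) :
    ∃ j, (b.take j).sum ≤ s ∧ s < (b.take j).sum + m := by
  induction b generalizing s with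
  | nil => exact ⟨0, by simp, by simp at hs ⊢; omega⟩
  | cons x b ih =>
    by_cases hx : s < x
    · exact ⟨0, by simp, by have := hb x (by simp); simp; omega⟩
    · rw [List.sum_cons] at hs
      obtain ⟨j, h₁, h₂⟩ := ih (fun y hy => hb y (by simp [hy])) (s := s - x) (by omega)
      exact ⟨j + 1, by simp; omega, by simp; omega⟩

theorem reducible_coe_of_sum_le {m : ℕ} (hm : 1 ≤ m) {a b : List ℕ} (ha : a.length = m)
    (ha1 : ∀ x ∈ a, 1 ≤ x) (hb : ∀ x ∈ b, x ≤ m) (hab : a.sum ≤ b.sum) :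
    Reducible a b := by
  have hs (i : ℕ) : (a.take i).sum ≤ b.sum := (a.take_sublist i).sum_le_sum (by simp) |>.trans hab
  choose f hf₁ hf₂ using fun i => List.exists_sum_take_le_lt_add hm hb (hs i)
  have hstrict {i k : ℕ} (hik : i < k) (hk : k ≤ m) : (a.take i).sum < (a.take k).sum := by
    have hi : i < a.length := by omega
    have h₁ : (a.take (i + 1)).sum = (a.take i).sum + a[i] := List.sum_take_succ a i hi
    have h₂ : (a.take (i + 1)).sum ≤ (a.take k).sum := a.sum_take_mono hik
    have h₃ := ha1 a[i] (List.getElem_mem hi)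
    omega
  obtain ⟨i, hi, k, hk, hne, heq⟩ := Finset.exists_ne_map_eq_of_card_lt_of_maps_to
    (s := Finset.range (m + 1)) (t := Finset.range m)
    (f := fun i => (a.take i).sum - (b.take (f i)).sum) (by simp)
    (fun i _ => by
      have := hf₁ i
      have := hf₂ i
      simp only [Finset.coe_range, Set.mem_Iio]
      omega)
  wlog hik : i < k generalizing i k
  · exact this k hk i hi hne.symm heq.symm (by omega)
  have hlt := hstrict hik (by simpa [Nat.lt_succ_iff] using hk)
  have hi₁ := hf₁ i
  have hk₁ := hf₁ k
  obtain ⟨A₀, hA, hA0, hAs⟩ := List.exists_le_sum_add_sum_take hlt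
  obtain ⟨B₀, hB, hB0, hBs⟩ := List.exists_le_sum_add_sum_take
    (l := b) (i := f i) (j := f k) (by omega)
  exact ⟨A₀, B₀, hA, hB, hA0, hB0, by omega⟩

theorem reducible_of_card_ge (m : ℕ) (hm : 1 ≤ m) (A B : Multiset ℕ)
    (hA : ∀ a ∈ A, 1 ≤ a ∧ a ≤ m) (hB : ∀ b ∈ B, 1 ≤ b ∧ b ≤ m)
    (hAcard : m ≤ Multiset.card A) (hBcard : m ≤ Multiset.card B) :
    Reducible A B := by
  obtain ⟨a, rfl⟩ : ∃ a : List ℕ, (a : Multiset ℕ) = A := ⟨A.toList, A.coe_toList⟩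
  obtain ⟨b, rfl⟩ : ∃ b : List ℕ, (b : Multiset ℕ) = B := ⟨B.toList, B.coe_toList⟩
  simp only [Multiset.mem_coe, Multiset.coe_card] at hA hB hAcard hBcard
  have hA' : ∀ x ∈ a.take m, 1 ≤ x ∧ x ≤ m := fun x hx => hA x (List.mem_of_mem_take hx)
  have hB' : ∀ x ∈ b.take m, 1 ≤ x ∧ x ≤ m := fun x hx => hB x (List.mem_of_mem_take hx)
  refine Reducible.mono (A := (a.take m : List ℕ)) (B := (b.take m : List ℕ))
    (a.take_sublist m).subperm (b.take_sublist m).subperm ?_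
  rcases le_total (a.take m).sum (b.take m).sum with h | h
  · exact reducible_coe_of_sum_le hm (by simpa using hAcard)
      (fun x hx => (hA' x hx).1) (fun x hx => (hB' x hx).2) h
  · exact (reducible_coe_of_sum_le hm (by simpa using hBcard)
      (fun x hx => (hB' x hx).1) (fun x hx => (hA' x hx).2) h).symm
end

section
/- Let 0 ≤ k < n·m and let x be an optimal k-profile. Then there exists an optimal (k+1)-profile y such that Σ_{i=1}^n |y_i − x_i| < 2m². -/
/-- `x` is a `k`-profile: each project gets between `0` and `m` efforts and the
total number of efforts is `k`. -/
def IsProfile (n m k : ℕ) (x : Fin n → ℕ) : Prop :=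
  (∀ j, x j ≤ m) ∧ ∑ j, x j = k

/-- The revenue of a profile. -/
def revenue {n : ℕ} (R : Fin n → ℕ → ℝ) (x : Fin n → ℕ) : ℝ :=
  ∑ j, R j (x j)

/-- `x` is an optimal `k`-profile. -/
def IsOptimalProfile (n m k : ℕ) (R : Fin n → ℕ → ℝ) (x : Fin n → ℕ) : Prop :=
  IsProfile n m k x ∧ ∀ y, IsProfile n m k y → revenue R y ≤ revenue R x

/-- A finite family of at least `2 * m` nonzero integers of absolute value at most `m` whose
sum is `1` has a nonempty subfamily with sum zero. -/
theorem exists_nonempty_subset_sum_eq_zero {ι : Type*} [DecidableEq ι] {m : ℕ} {d : ι → ℤ}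
    {T : Finset ι} (hd : ∀ i ∈ T, d i ≠ 0) (hm : ∀ i ∈ T, |d i| ≤ m)
    (hsum : ∑ i ∈ T, d i = 1) (hcard : 2 * m ≤ T.card) :
    ∃ S ⊆ T, S.Nonempty ∧ ∑ i ∈ S, d i = 0 := by
  by_contra! hno
  have hm1 : 1 ≤ m := by
    obtain ⟨i, hi⟩ : T.Nonempty := by
      rw [Finset.nonempty_iff_ne_empty]
      rintro rfl
      simp at hsum
    have h1 := abs_pos.mpr (hd i hi)
    have h2 := hm i hi
    omega
  -- Add elements one by one, keeping the partial sums in `[1 - m, m]`.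
  have key : ∀ t ≤ T.card, ∃ U ⊆ T, ∃ V ⊆ Finset.Icc (1 - m : ℤ) m, U.card = t ∧
      V.card = t + 1 ∧ ∑ i ∈ U, d i ∈ V ∧ ∀ v ∈ V, ∃ W ⊆ U, ∑ i ∈ W, d i = v := by
    intro t
    induction t with
    | zero =>
      intro _
      refine ⟨∅, by simp, {0}, ?_, by simp, by simp, by simp, ?_⟩
      · simp only [Finset.singleton_subset_iff, Finset.mem_Icc]
        omega
      · exact fun v hv => ⟨∅, by simp, by simpa [eq_comm] using hv⟩
    | succ t ih =>
      intro ht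
      obtain ⟨U, hUT, V, hV, hU, hVc, hUV, hW⟩ := ih (by omega)
      have hrest := Finset.sum_sdiff (f := d) hUT
      have hne : (T \ U).Nonempty := by
        rw [← Finset.card_pos, Finset.card_sdiff_of_subset hUT]
        omega
      have hs := Finset.mem_Icc.mp (hV hUV)
      obtain ⟨i, hi, hiIcc⟩ : ∃ i ∈ T \ U, d i + ∑ j ∈ U, d j ∈ Finset.Icc (1 - m : ℤ) m := by
        by_cases h0 : ∑ j ∈ U, d j ≤ 0
        · obtain ⟨i, hi, hpos⟩ : ∃ i ∈ T \ U, 0 < d i := by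
            by_contra! h
            have := Finset.sum_nonpos h
            omega
          have := abs_le.mp (hm i (Finset.mem_sdiff.mp hi).1)
          exact ⟨i, hi, Finset.mem_Icc.mpr (by omega)⟩
        · obtain ⟨i, hi, hneg⟩ : ∃ i ∈ T \ U, d i < 0 := by
            by_contra! h
            have := Finset.sum_pos (fun i hi =>
              lt_of_le_of_ne (h i hi) (hd i (Finset.mem_sdiff.mp hi).1).symm) hne
            omega
          have := abs_le.mp (hm i (Finset.mem_sdiff.mp hi).1)
          exact ⟨i, hi, Finset.mem_Icc.mpr (by omega)⟩
      obtain ⟨hiT, hiU⟩ := Finset.mem_sdiff.mp hi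
      have hins : insert i U ⊆ T := Finset.insert_subset hiT hUT
      have hnew : d i + ∑ j ∈ U, d j ∉ V := by
        intro hmem
        obtain ⟨W, hWU, hWs⟩ := hW _ hmem
        refine hno (insert i U \ W) (Finset.sdiff_subset.trans hins)
          ⟨i, Finset.mem_sdiff.mpr ⟨Finset.mem_insert_self i U, fun h => hiU (hWU h)⟩⟩ ?_
        have h1 := Finset.sum_sdiff (f := d) (hWU.trans (Finset.subset_insert i U))
        rw [Finset.sum_insert hiU] at h1
        omega
      refine ⟨insert i U, hins, insert (d i + ∑ j ∈ U, d j) V, Finset.insert_subset hiIcc hV,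
        by rw [Finset.card_insert_of_notMem hiU, hU],
        by rw [Finset.card_insert_of_notMem hnew, hVc],
        by rw [Finset.sum_insert hiU]; exact Finset.mem_insert_self _ _, ?_⟩
      intro v hv
      rcases Finset.mem_insert.mp hv with rfl | hv
      · exact ⟨insert i U, subset_rfl, Finset.sum_insert hiU⟩
      · obtain ⟨W, hWU, hWs⟩ := hW v hv
        exact ⟨W, hWU.trans (Finset.subset_insert i U), hWs⟩
  obtain ⟨-, -, V, hV, -, hVc, -, -⟩ := key _ le_rfl
  have := Finset.card_le_card hV
  rw [Int.card_Icc] at this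
  omega

theorem finite_setOf_isProfile (n m k : ℕ) : {x | IsProfile n m k x}.Finite :=
  (Set.finite_Iic (fun _ : Fin n => m)).subset fun _ hx => hx.1

theorem IsProfile.exists_succ {n m k : ℕ} {x : Fin n → ℕ} (hx : IsProfile n m k x)
    (hk : k < n * m) : ∃ y, IsProfile n m (k + 1) y := by
  obtain ⟨j, hj⟩ : ∃ j, x j < m := by
    by_contra! h
    have := Finset.sum_le_sum fun j (_ : j ∈ Finset.univ) => h j
    rw [hx.2] at this
    simp at this
    omega
  refine ⟨x + Pi.single j 1, fun i => ?_, ?_⟩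
  · by_cases hi : i = j
    · subst hi
      simpa using hj
    · simpa [hi] using hx.1 i
  · simp [Finset.sum_add_distrib, hx.2]

theorem IsProfile.exists_isOptimalProfile {n m k : ℕ} {x : Fin n → ℕ} (hx : IsProfile n m k x)
    (R : Fin n → ℕ → ℝ) : ∃ y, IsOptimalProfile n m k R y :=
  Set.exists_max_image _ (revenue R) (finite_setOf_isProfile n m k) ⟨x, hx⟩

/-- Replacing `x` by `y` on a set where both have the same total keeps the total. -/
theorem IsProfile.piecewise {n m k : ℕ} {x y : Fin n → ℕ} {S : Finset (Fin n)}
    (hx : IsProfile n m k x) (hy : ∀ j, y j ≤ m) (hS : ∑ j ∈ S, y j = ∑ j ∈ S, x j) :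
    IsProfile n m k (S.piecewise y x) := by
  refine ⟨fun j => ?_, ?_⟩
  · by_cases hj : j ∈ S
    · simpa [hj] using hy j
    · simpa [hj] using hx.1 j
  · rw [Finset.sum_piecewise, Finset.univ_inter, hS, ← hx.2, add_comm]
    exact Finset.sum_sdiff (Finset.subset_univ S)

theorem revenue_piecewise_add_revenue_piecewise {n : ℕ} (R : Fin n → ℕ → ℝ) (x y : Fin n → ℕ)
    (S : Finset (Fin n)) :
    revenue R (S.piecewise y x) + revenue R (S.piecewise x y) = revenue R x + revenue R y := by
  simp only [revenue, ← Finset.sum_add_distrib]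
  refine Finset.sum_congr rfl fun j _ => ?_
  by_cases hj : j ∈ S
  · simp [hj, add_comm]
  · simp [hj]

/-- Optimal profiles can be exchanged on a set where they have the same total. -/
theorem IsOptimalProfile.piecewise {n m k l : ℕ} {R : Fin n → ℕ → ℝ} {x y : Fin n → ℕ}
    {S : Finset (Fin n)} (hx : IsOptimalProfile n m k R x) (hy : IsOptimalProfile n m l R y)
    (hS : ∑ j ∈ S, x j = ∑ j ∈ S, y j) : IsOptimalProfile n m l R (S.piecewise x y) := by
  refine ⟨hy.1.piecewise hx.1.1 hS, fun z hz => ?_⟩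
  have h1 := hx.2 _ (hx.1.piecewise hy.1.1 hS.symm)
  have h2 := revenue_piecewise_add_revenue_piecewise R x y S
  have h3 := hy.2 z hz
  linarith

theorem exists_optimal_succ_profile_close
    (n m k : ℕ) (R : Fin n → ℕ → ℝ) (hk : k < n * m)
    (x : Fin n → ℕ) (hx : IsOptimalProfile n m k R x) :
    ∃ y : Fin n → ℕ, IsOptimalProfile n m (k + 1) R y ∧
      (∑ i, |(y i : ℤ) - (x i : ℤ)|) < 2 * (m : ℤ) ^ 2 := by
  obtain ⟨w, hw⟩ := hx.1.exists_succ hk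
  obtain ⟨y, hy, hmin⟩ := Set.exists_min_image {y | IsOptimalProfile n m (k + 1) R y}
    (fun y => ∑ i, |(y i : ℤ) - (x i : ℤ)|)
    ((finite_setOf_isProfile n m (k + 1)).subset fun _ hy => hy.1) (hw.exists_isOptimalProfile R)
  refine ⟨y, hy, ?_⟩
  by_contra! hlarge
  have hm0 : 0 < m := Nat.pos_of_ne_zero (by rintro rfl; simp at hk)
  have habs : ∀ i, |(y i : ℤ) - (x i : ℤ)| ≤ m := fun i => by
    have h1 := hx.1.1 i
    have h2 := hy.1.1 i
    exact abs_le.mpr (by omega)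
  let T : Finset (Fin n) := {i | (y i : ℤ) - (x i : ℤ) ≠ 0}
  have hT : ∀ i ∈ T, (y i : ℤ) - (x i : ℤ) ≠ 0 := fun i hi => (Finset.mem_filter.mp hi).2
  have hsum : ∑ i ∈ T, ((y i : ℤ) - (x i : ℤ)) = 1 := by
    rw [Finset.sum_filter_ne_zero, Finset.sum_sub_distrib, ← Nat.cast_sum, ← Nat.cast_sum,
      hx.1.2, hy.1.2]
    simp
  have hcard : 2 * m ≤ T.card := by
    have h1 : ∑ i, |(y i : ℤ) - (x i : ℤ)| = ∑ i ∈ T, |(y i : ℤ) - (x i : ℤ)| := by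
      refine (Finset.sum_subset (Finset.subset_univ T) fun i _ hi => ?_).symm
      simpa [T] using hi
    have h2 := Finset.sum_le_card_nsmul T _ (m : ℤ) fun i _ => habs i
    rw [← h1, nsmul_eq_mul] at h2
    have h3 : (2 * m * m : ℤ) ≤ T.card * m := by linarith [sq (m : ℤ)]
    exact Nat.le_of_mul_le_mul_right (by exact_mod_cast h3) hm0
  obtain ⟨S, hST, ⟨i, hi⟩, hS⟩ :=
    exists_nonempty_subset_sum_eq_zero hT (fun i _ => habs i) hsum hcard
  have hSxy : ∑ j ∈ S, x j = ∑ j ∈ S, y j := by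
    rw [Finset.sum_sub_distrib, sub_eq_zero] at hS
    exact_mod_cast hS.symm
  refine absurd (hmin _ (hx.piecewise hy hSxy)) (not_le.mpr ?_)
  refine Finset.sum_lt_sum (fun j _ => ?_) ⟨i, Finset.mem_univ i, ?_⟩
  · by_cases hj : j ∈ S <;> simp [hj]
  · simpa [hi] using hT i (hST hi)
end

section
/- Let a_1, ..., a_n and b_1, ..., b_n be real numbers with a_i ≤ b_i for every i, and suppose the projects are sorted so that a_1 + b_1 ≥ a_2 + b_2 ≥ ... ≥ a_n + b_n. For 0 ≤ k ≤ 2n let g(k) be the maximum of Σ_{i : x_i ≥ 1} a_i + Σ_{i : x_i = 2} b_i over all vectors x ∈ {0,1,2}^n with Σ_i x_i = k. Then g(2k+2) + g(2k) ≥ 2·g(2k+1) for all 0 ≤ k ≤ n−1. -/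
/-- Total revenue of an allocation `x` (with `x i ∈ {0,1,2}`) to projects `1, …, n`:
project `i` yields `0`, `a i`, or `a i + b i` when allocated `0`, `1`, or `2` efforts. -/
def rev (n : ℕ) (a b : ℕ → ℝ) (x : ℕ → ℕ) : ℝ :=
  ∑ i ∈ Finset.Icc 1 n, ((if 1 ≤ x i then a i else 0) + (if x i = 2 then b i else 0))

/-- Changing the value of `x` at one index `i` changes a sum of terms `F j (x j)` only at `i`. -/
theorem sum_update_add {M : Type*} [AddCommMonoid M] {s : Finset ℕ} {i : ℕ} (hi : i ∈ s)
    (F : ℕ → ℕ → M) (x : ℕ → ℕ) (v : ℕ) :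
    ∑ j ∈ s, F j (Function.update x i v j) + F i (x i) = ∑ j ∈ s, F j (x j) + F i v := by
  have h : ∑ j ∈ s.erase i, F j (Function.update x i v j) = ∑ j ∈ s.erase i, F j (x j) :=
    Finset.sum_congr rfl fun j hj => by rw [Function.update_of_ne (Finset.ne_of_mem_erase hj)]
  rw [← Finset.add_sum_erase s _ hi, ← Finset.add_sum_erase s (fun j => F j (x j)) hi, h,
    Function.update_self]
  abel

theorem rev_update_add {n i : ℕ} (hi : i ∈ Finset.Icc 1 n) (a b : ℕ → ℝ) (x : ℕ → ℕ) (v : ℕ) :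
    rev n a b (Function.update x i v)
        + ((if 1 ≤ x i then a i else 0) + (if x i = 2 then b i else 0)) =
      rev n a b x + ((if 1 ≤ v then a i else 0) + (if v = 2 then b i else 0)) :=
  sum_update_add hi (fun j w => (if 1 ≤ w then a j else 0) + (if w = 2 then b j else 0)) x v

theorem update_le_two {n i v : ℕ} {x : ℕ → ℕ} (hx : ∀ j ∈ Finset.Icc 1 n, x j ≤ 2) (hv : v ≤ 2) :
    ∀ j ∈ Finset.Icc 1 n, Function.update x i v j ≤ 2 := by
  intro j hj
  rw [Function.update_apply]
  split_ifs
  exacts [hv, hx j hj]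

/-- An allocation of an odd number of efforts is dominated, on average, by an allocation with
one more effort and an allocation with one fewer. -/
theorem exists_rev_add_rev_ge {n : ℕ} {a b : ℕ → ℝ} (hab : ∀ i ∈ Finset.Icc 1 n, a i ≤ b i)
    (k : ℕ) (x : ℕ → ℕ) (hx : ∀ i ∈ Finset.Icc 1 n, x i ≤ 2)
    (hsum : ∑ i ∈ Finset.Icc 1 n, x i = 2 * k + 1) :
    ∃ y z : ℕ → ℕ, (∀ i ∈ Finset.Icc 1 n, y i ≤ 2) ∧ (∀ i ∈ Finset.Icc 1 n, z i ≤ 2) ∧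
      ∑ i ∈ Finset.Icc 1 n, y i = 2 * k + 2 ∧ ∑ i ∈ Finset.Icc 1 n, z i = 2 * k ∧
      2 * rev n a b x ≤ rev n a b y + rev n a b z := by
  obtain ⟨i, hi, hxi⟩ : ∃ i ∈ Finset.Icc 1 n, x i = 1 := by
    by_contra! hne
    have hdvd : 2 ∣ ∑ i ∈ Finset.Icc 1 n, x i := Finset.dvd_sum fun i hi => by
      have h₁ := hx i hi
      have h₂ := hne i hi
      omega
    omega
  refine ⟨Function.update x i 2, Function.update x i 0, update_le_two hx le_rfl,
    update_le_two hx (by norm_num), ?_, ?_, ?_⟩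
  · have h₁ := sum_update_add hi (fun _ w => w) x 2
    simp only [hxi] at h₁
    omega
  · have h₁ := sum_update_add hi (fun _ w => w) x 0
    simp only [hxi] at h₁
    omega
  · have h₁ := rev_update_add hi a b x 2
    have h₂ := rev_update_add hi a b x 0
    norm_num [hxi] at h₁ h₂
    linarith [hab i hi]

theorem max_revenue_property_two
    (n : ℕ) (a b : ℕ → ℝ) (g : ℕ → ℝ)
    (hab : ∀ i ∈ Finset.Icc 1 n, a i ≤ b i)
    (hsort : ∀ i j : ℕ, 1 ≤ i → i ≤ j → j ≤ n → a j + b j ≤ a i + b i)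
    (hg : ∀ k ≤ 2 * n,
      IsGreatest
        {r : ℝ | ∃ x : ℕ → ℕ, (∀ i ∈ Finset.Icc 1 n, x i ≤ 2) ∧
          (∑ i ∈ Finset.Icc 1 n, x i = k) ∧ r = rev n a b x}
        (g k)) :
    ∀ k : ℕ, k + 1 ≤ n → 2 * g (2 * k + 1) ≤ g (2 * k + 2) + g (2 * k) := by
  intro k hk
  obtain ⟨x, hx, hsum, hrev⟩ := (hg (2 * k + 1) (by omega)).1
  obtain ⟨y, z, hy, hz, hys, hzs, hyz⟩ := exists_rev_add_rev_ge hab k x hx hsum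
  have hgy := (hg (2 * k + 2) (by omega)).2 ⟨y, hy, hys, rfl⟩
  have hgz := (hg (2 * k) (by omega)).2 ⟨z, hz, hzs, rfl⟩
  linarith
end
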